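/- (Theorem 4.1, part 3: eventual uniform boundedness) Under the standing hypotheses with ρ = ∞ (i.e. F'(z) ≤ k for all z ∈ ℝ) and 0 ≤ τ < 1, if sup_{t>0} g(t) < ∞ and C'(t) → 0 as t → ∞, then the solutions are eventually uniformly bounded: for every δ > 0 there exist s(δ) ≥ 0 and β(δ) > 0 such that for every t₀ ≥ s(δ) every classical solution u on [t₀,∞) with d(t₀) ≤ δ satisfies d(t) < β(δ) for all t ≥ t₀. -/

import Mathlib

open Real Set MeasureTheory Filter

/-- A classical solution on `[t₀, ∞)` of the initial-boundary-value problem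
`-ε(t) u_xxt + u_tt - C(t) u_xx + a' u_t = F(u) - a u_t` on `(0,π) × (t₀,∞)`,
with Dirichlet boundary conditions `u(0,t) = u(π,t) = 0`.  The partial
derivatives are recorded as data, together with the hypotheses that they really
are the derivatives and that all of them are continuous on the closed
space-time domain. -/
structure ClassicalSolution (ε C F : ℝ → ℝ) (a' t₀ : ℝ) where
  u : ℝ → ℝ → ℝ
  ux : ℝ → ℝ → ℝ
  uxx : ℝ → ℝ → ℝ
  ut : ℝ → ℝ → ℝ
  utt : ℝ → ℝ → ℝ
  uxxt : ℝ → ℝ → ℝ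
  aa : ℝ → ℝ → ℝ
  hux : ∀ t ∈ Ici t₀, ∀ x ∈ Icc (0:ℝ) π,
    HasDerivWithinAt (fun y => u y t) (ux x t) (Icc 0 π) x
  huxx : ∀ t ∈ Ici t₀, ∀ x ∈ Icc (0:ℝ) π,
    HasDerivWithinAt (fun y => ux y t) (uxx x t) (Icc 0 π) x
  hut : ∀ x ∈ Icc (0:ℝ) π, ∀ t ∈ Ici t₀,
    HasDerivWithinAt (fun s => u x s) (ut x t) (Ici t₀) t
  hutt : ∀ x ∈ Icc (0:ℝ) π, ∀ t ∈ Ici t₀,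
    HasDerivWithinAt (fun s => ut x s) (utt x t) (Ici t₀) t
  huxxt : ∀ x ∈ Icc (0:ℝ) π, ∀ t ∈ Ici t₀,
    HasDerivWithinAt (fun s => uxx x s) (uxxt x t) (Ici t₀) t
  cont_u : ContinuousOn (Function.uncurry u) (Icc 0 π ×ˢ Ici t₀)
  cont_ux : ContinuousOn (Function.uncurry ux) (Icc 0 π ×ˢ Ici t₀)
  cont_uxx : ContinuousOn (Function.uncurry uxx) (Icc 0 π ×ˢ Ici t₀)
  cont_ut : ContinuousOn (Function.uncurry ut) (Icc 0 π ×ˢ Ici t₀)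
  cont_utt : ContinuousOn (Function.uncurry utt) (Icc 0 π ×ˢ Ici t₀)
  cont_uxxt : ContinuousOn (Function.uncurry uxxt) (Icc 0 π ×ˢ Ici t₀)
  cont_aa : ContinuousOn (Function.uncurry aa) (Icc 0 π ×ˢ Ici t₀)
  aa_nonneg : ∀ x ∈ Icc (0:ℝ) π, ∀ t ∈ Ici t₀, 0 ≤ aa x t
  pde : ∀ x ∈ Ioo (0:ℝ) π, ∀ t ∈ Ioi t₀,
    -(ε t) * uxxt x t + utt x t - C t * uxx x t + a' * ut x t
      = F (u x t) - aa x t * ut x t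
  bc0 : ∀ t ∈ Ici t₀, u 0 t = 0
  bcπ : ∀ t ∈ Ici t₀, u π t = 0

/-- The time-dependent norm `d(t)` of a solution:
`d(t)² = ∫₀^π [ε(t)² u_xx² + u_x² + u² + u_t²] dx`. -/
noncomputable def ClassicalSolution.d {ε C F : ℝ → ℝ} {a' t₀ : ℝ}
    (S : ClassicalSolution ε C F a' t₀) (t : ℝ) : ℝ :=
  Real.sqrt (∫ x in (0:ℝ)..π,
    ((ε t)^2 * (S.uxx x t)^2 + (S.ux x t)^2 + (S.u x t)^2 + (S.ut x t)^2))

open scoped Interval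

lemma wirt_aux {f f' : ℝ → ℝ} (hf : ∀ x ∈ Icc (0:ℝ) π, HasDerivWithinAt f (f' x) (Icc 0 π) x)
    (hc : ContinuousOn f' (Icc 0 π)) (h0 : f 0 = 0) (hπ : f π = 0) :
    0 ≤ ∫ x in (0:ℝ)..π, (f' x ^ 2 - f x ^ 2) := by
  have hfc : ContinuousOn f (Icc 0 π) := fun x hx => (hf x hx).continuousWithinAt
  obtain ⟨L, hL⟩ := isCompact_Icc.exists_bound_of_continuousOn hc
  have h0m : (0:ℝ) ∈ Icc (0:ℝ) π := ⟨le_rfl, pi_pos.le⟩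
  have hπm : π ∈ Icc (0:ℝ) π := ⟨pi_pos.le, le_rfl⟩
  have hLn : 0 ≤ L := (norm_nonneg _).trans (hL 0 h0m)
  have hb : ∀ x ∈ Icc (0:ℝ) π, |f x| ≤ (L * (π / 2)) * sin x := by
    intro x hx
    have h1 := Convex.norm_image_sub_le_of_norm_hasDerivWithin_le hf hL (convex_Icc 0 π) h0m hx
    have h2 := Convex.norm_image_sub_le_of_norm_hasDerivWithin_le hf hL (convex_Icc 0 π) hπm hx
    rw [h0, sub_zero, sub_zero, Real.norm_eq_abs, Real.norm_eq_abs, abs_of_nonneg hx.1] at h1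
    rw [hπ, sub_zero, Real.norm_eq_abs, Real.norm_eq_abs, abs_of_nonpos (sub_nonpos.2 hx.2 : x - π ≤ 0)] at h2
    have key : ∀ y, 0 ≤ y → y ≤ π / 2 → y ≤ (π / 2) * sin y := by
      intro y hy hy'
      have := mul_le_sin hy hy'
      have h3 := mul_le_mul_of_nonneg_left this (by positivity : 0 ≤ π / 2)
      have : π / 2 * (2 / π * y) = y := by field_simp
      linarith
    rcases le_total x (π / 2) with h | h
    · have := mul_le_mul_of_nonneg_left (key x hx.1 h) hLn
      linarith
    · have h4 := key (π - x) (by linarith [hx.2]) (by linarith)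
      rw [sin_pi_sub] at h4
      have := mul_le_mul_of_nonneg_left h4 hLn
      linarith
  set K := L * (π / 2) with hK
  have hKn : 0 ≤ K := by positivity
  set G : ℝ → ℝ := fun x => f x ^ 2 * cos x / sin x with hG
  have hGb : ∀ x ∈ Icc (0:ℝ) π, |G x| ≤ K * |f x| := by
    intro x hx
    have hs : 0 ≤ sin x := sin_nonneg_of_nonneg_of_le_pi hx.1 hx.2
    rcases hs.eq_or_lt with hs | hs
    · simp [hG, ← hs]; positivity
    · rw [hG]; simp only
      rw [abs_div, abs_of_pos hs, div_le_iff₀ hs, abs_mul, abs_pow, sq]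
      have h1 := abs_cos_le_one x
      have h2 := hb x hx
      calc |f x| * |f x| * |cos x| ≤ |f x| * |f x| * 1 := by gcongr
        _ ≤ |f x| * (K * sin x) := by rw [mul_one]; gcongr
        _ = _ := by ring
  have hend : ∀ x ∈ Icc (0:ℝ) π, f x = 0 → ContinuousWithinAt G (Icc 0 π) x := by
    intro x hx hfx
    have : G x = 0 := by simp [hG, hfx]
    rw [ContinuousWithinAt, this]
    apply squeeze_zero_norm' (a := fun y => K * |f y|)
    · filter_upwards [self_mem_nhdsWithin] with y hy using hGb y hy
    · have := ((hfc x hx).abs).const_mul K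
      simpa [ContinuousWithinAt, hfx] using this
  have hin : ∀ x ∈ Ioo (0:ℝ) π, HasDerivAt G
      (((2 * f x * f' x) * cos x + f x ^ 2 * (- sin x)) / sin x - (f x ^ 2 * cos x) * cos x / sin x ^ 2) x := by
    intro x hx
    have h1 := (hf x (mem_Icc_of_Ioo hx)).hasDerivAt (Icc_mem_nhds hx.1 hx.2)
    have hs := sin_pos_of_pos_of_lt_pi hx.1 hx.2
    have := ((h1.pow 2).mul (hasDerivAt_cos x)).div (hasDerivAt_sin x) hs.ne'
    refine this.congr_deriv ?_
    simp only [Pi.mul_apply, Pi.pow_apply]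
    field_simp
    push_cast
    ring
  have hGc : ContinuousOn G (Icc 0 π) := by
    intro x hx
    rcases hx.1.eq_or_lt with h | h
    · exact hend x hx (by rw [← h, h0])
    rcases hx.2.eq_or_lt with h' | h'
    · exact hend x hx (by rw [h', hπ])
    exact (hin x ⟨h, h'⟩).continuousAt.continuousWithinAt
  have := intervalIntegral.sub_le_integral_of_hasDeriv_right_of_le (φ := fun x => f' x ^ 2 - f x ^ 2) pi_pos.le hGc
    (fun x hx => (hin x hx).hasDerivWithinAt) (((hc.pow 2).sub (hfc.pow 2)).integrableOn_Icc) ?_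
  · simpa [hG] using this
  · intro x hx
    have hs := sin_pos_of_pos_of_lt_pi hx.1 hx.2
    have h1 : f' x ^ 2 - f x ^ 2 - (((2 * f x * f' x) * cos x + f x ^ 2 * (- sin x)) / sin x - (f x ^ 2 * cos x) * cos x / sin x ^ 2) = (f' x - f x * cos x / sin x) ^ 2 := by
      field_simp; ring
    have := sq_nonneg (f' x - f x * cos x / sin x)
    linarith

lemma ibp0 {f f' g g' : ℝ → ℝ} (hf : ∀ x ∈ Icc (0:ℝ) π, HasDerivWithinAt f (f' x) (Icc 0 π) x)
    (hg : ∀ x ∈ Icc (0:ℝ) π, HasDerivWithinAt g (g' x) (Icc 0 π) x)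
    (hf' : ContinuousOn f' (Icc 0 π)) (hg' : ContinuousOn g' (Icc 0 π)) (h0 : f 0 = 0) (hπ : f π = 0) :
    ∫ x in (0:ℝ)..π, f x * g' x = - ∫ x in (0:ℝ)..π, f' x * g x := by
  rw [intervalIntegral.integral_mul_deriv_eq_deriv_mul_of_hasDerivWithinAt (u := f) (v := g) (u' := f') (v' := g')]
  · simp [h0, hπ]
  · rwa [uIcc_of_le pi_pos.le]
  · rwa [uIcc_of_le pi_pos.le]
  · exact hf'.intervalIntegrable_of_Icc pi_pos.le
  · exact hg'.intervalIntegrable_of_Icc pi_pos.le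

lemma wirt {f f' f'' : ℝ → ℝ} (hf : ∀ x ∈ Icc (0:ℝ) π, HasDerivWithinAt f (f' x) (Icc 0 π) x)
    (hf' : ∀ x ∈ Icc (0:ℝ) π, HasDerivWithinAt f' (f'' x) (Icc 0 π) x)
    (hc : ContinuousOn f'' (Icc 0 π)) (h0 : f 0 = 0) (hπ : f π = 0) :
    ∫ x in (0:ℝ)..π, (f x * f'' x + f x ^ 2) ≤ 0 := by
  have hfc : ContinuousOn f (Icc 0 π) := fun x hx => (hf x hx).continuousWithinAt
  have hfc' : ContinuousOn f' (Icc 0 π) := fun x hx => (hf' x hx).continuousWithinAt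
  have h1 := wirt_aux hf hfc' h0 hπ
  have h2 := ibp0 hf hf' hfc' hc h0 hπ
  rw [intervalIntegral.integral_sub ((hfc'.fun_pow 2).intervalIntegrable_of_Icc pi_pos.le)
    ((hfc.fun_pow 2).intervalIntegrable_of_Icc pi_pos.le)] at h1
  rw [intervalIntegral.integral_add ((hfc.fun_mul hc).intervalIntegrable_of_Icc pi_pos.le)
    ((hfc.fun_pow 2).intervalIntegrable_of_Icc pi_pos.le), h2]
  simp only [← sq]
  linarith

lemma param_cont {f : ℝ → ℝ → ℝ} {t₀ : ℝ}
    (hf : ContinuousOn (Function.uncurry f) (Icc 0 π ×ˢ Ici t₀)) :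
    ContinuousOn (fun t => ∫ x in (0:ℝ)..π, f x t) (Ici t₀) := by
  set g : ℝ → ℝ → ℝ := fun t x => f (max 0 (min x π)) (max t t₀) with hg
  have hgc : Continuous (Function.uncurry g) := by
    have : Function.uncurry g = Function.uncurry f ∘ (fun p : ℝ × ℝ => (max 0 (min p.2 π), max p.1 t₀)) := by
      ext p; rfl
    rw [this]
    apply hf.comp_continuous (by fun_prop)
    intro p
    exact ⟨⟨le_max_left _ _, max_le pi_pos.le (min_le_right _ _)⟩, mem_Ici.2 (le_max_right _ _)⟩
  have := intervalIntegral.continuous_parametric_intervalIntegral_of_continuous' (μ := volume) hgc 0 π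
  refine this.continuousOn.congr ?_
  intro t ht
  apply intervalIntegral.integral_congr
  intro x hx
  rw [uIcc_of_le pi_pos.le] at hx
  simp only [hg, min_eq_left hx.2, max_eq_right hx.1, max_eq_left (show t₀ ≤ t from ht)]

lemma slice_cont {f : ℝ → ℝ → ℝ} {t₀ : ℝ}
    (hf : ContinuousOn (Function.uncurry f) (Icc 0 π ×ˢ Ici t₀)) {t : ℝ} (ht : t₀ ≤ t) :
    ContinuousOn (fun x => f x t) (Icc 0 π) := by
  have : (fun x => f x t) = Function.uncurry f ∘ (fun x => (x, t)) := rfl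
  rw [this]
  exact hf.comp (by fun_prop) (fun x hx => ⟨hx, ht⟩)

lemma param_bound {f : ℝ → ℝ → ℝ} {t₀ : ℝ}
    (hf : ContinuousOn (Function.uncurry f) (Icc 0 π ×ˢ Ici t₀)) (t : ℝ) :
    ∃ M, ∀ x ∈ Icc (0:ℝ) π, ∀ s ∈ Icc t₀ t, ‖f x s‖ ≤ M := by
  obtain ⟨M, hM⟩ := (isCompact_Icc (a := (0:ℝ)) (b := π)).prod (isCompact_Icc (a := t₀) (b := t))
    |>.exists_bound_of_continuousOn (hf.mono (prod_mono le_rfl Icc_subset_Ici_self))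
  exact ⟨M, fun x hx s hs => hM (x, s) ⟨hx, hs⟩⟩

lemma param_deriv {f f' : ℝ → ℝ → ℝ} {t₀ t : ℝ} (ht : t₀ < t)
    (hf : ContinuousOn (Function.uncurry f) (Icc 0 π ×ˢ Ici t₀))
    (hf' : ContinuousOn (Function.uncurry f') (Icc 0 π ×ˢ Ici t₀))
    (hd : ∀ x ∈ Icc (0:ℝ) π, ∀ t ∈ Ioi t₀, HasDerivAt (fun s => f x s) (f' x t) t) :
    HasDerivAt (fun t => ∫ x in (0:ℝ)..π, f x t) (∫ x in (0:ℝ)..π, f' x t) t := by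
  obtain ⟨M, hM⟩ := param_bound hf' (t + 1)
  have hI : Ι (0:ℝ) π = Ioc 0 π := uIoc_of_le pi_pos.le
  have hm : ∀ {g : ℝ → ℝ → ℝ}, ContinuousOn (Function.uncurry g) (Icc 0 π ×ˢ Ici t₀) → ∀ s, t₀ ≤ s →
      AEStronglyMeasurable (fun x => g x s) (volume.restrict (Ι (0:ℝ) π)) := by
    intro g hg s hs
    rw [hI]
    exact ((slice_cont hg hs).mono Ioc_subset_Icc_self).aestronglyMeasurable measurableSet_Ioc
  refine (intervalIntegral.hasDerivAt_integral_of_dominated_loc_of_deriv_le (F := fun s x => f x s)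
    (F' := fun s x => f' x s) (s := Ioo t₀ (t+1)) (bound := fun _ => M)
    (Ioo_mem_nhds ht (by linarith)) ?_ ?_ ?_ ?_ ?_ ?_).2
  · filter_upwards [Ioi_mem_nhds ht] with s hs using hm hf s (le_of_lt hs)
  · exact (slice_cont hf ht.le).intervalIntegrable_of_Icc pi_pos.le
  · exact hm hf' t ht.le
  · refine Eventually.of_forall fun x hx s hs => ?_
    rw [hI] at hx
    exact hM x (Ioc_subset_Icc_self hx) s ⟨hs.1.le, hs.2.le⟩
  · simp
  · refine Eventually.of_forall fun x hx s hs => ?_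
    rw [hI] at hx
    exact hd x (Ioc_subset_Icc_self hx) s hs.1

section sol
variable {ε C F : ℝ → ℝ} {a' t₀ : ℝ} (S : ClassicalSolution ε C F a' t₀)

lemma sol_wirt {t : ℝ} (ht : t₀ ≤ t) :
    ∫ x in (0:ℝ)..π, (S.u x t * S.uxx x t + S.u x t ^ 2) ≤ 0 :=
  wirt (S.hux t ht) (S.huxx t ht) (slice_cont S.cont_uxx ht) (S.bc0 t ht) (S.bcπ t ht)

lemma sol_ibp {t : ℝ} (ht : t₀ ≤ t) :
    ∫ x in (0:ℝ)..π, (S.u x t * S.uxx x t + S.ux x t ^ 2) = 0 := by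
  have h := ibp0 (S.hux t ht) (S.huxx t ht) (slice_cont S.cont_ux ht) (slice_cont S.cont_uxx ht)
    (S.bc0 t ht) (S.bcπ t ht)
  rw [intervalIntegral.integral_add
    (((slice_cont S.cont_u ht).fun_mul (slice_cont S.cont_uxx ht)).intervalIntegrable_of_Icc pi_pos.le)
    (((slice_cont S.cont_ux ht).fun_pow 2).intervalIntegrable_of_Icc pi_pos.le), h]
  simp only [← sq]; ring

lemma sol_F {F' : ℝ → ℝ} {k : ℝ} (hFderiv : ∀ z, HasDerivAt F (F' z) z)
    (hF'cont : Continuous F') (hF0 : F 0 = 0) (hFk : ∀ z, F' z ≤ k) {t : ℝ} (ht : t₀ ≤ t) :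
    ∫ x in (0:ℝ)..π, (- F (S.u x t) * S.uxx x t + k * (S.u x t * S.uxx x t)) ≤ 0 := by
  have cu := slice_cont S.cont_u ht
  have cux := slice_cont S.cont_ux ht
  have cuxx := slice_cont S.cont_uxx ht
  have hd : ∀ x ∈ Icc (0:ℝ) π, HasDerivWithinAt (fun y => k * S.u y t - F (S.u y t))
      ((k - F' (S.u x t)) * S.ux x t) (Icc 0 π) x := by
    intro x hx
    have h1 := S.hux t ht x hx
    have h2 := (hFderiv (S.u x t)).comp_hasDerivWithinAt x h1
    exact ((h1.const_mul k).sub h2).congr_deriv (by ring)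
  have cF' : ContinuousOn (fun x => F' (S.u x t)) (Icc 0 π) := hF'cont.comp_continuousOn cu
  have h := ibp0 hd (S.huxx t ht) ((continuousOn_const.sub cF').mul cux) cuxx
    (by simp [S.bc0 t ht, hF0]) (by simp [S.bcπ t ht, hF0])
  have e : ∀ x, - F (S.u x t) * S.uxx x t + k * (S.u x t * S.uxx x t) = (k * S.u x t - F (S.u x t)) * S.uxx x t := by
    intro x; ring
  simp only [e, h]
  rw [neg_nonpos]
  apply intervalIntegral.integral_nonneg pi_pos.le
  intro x hx
  have := mul_nonneg (sub_nonneg.2 (hFk (S.u x t))) (sq_nonneg (S.ux x t))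
  nlinarith

lemma sol_sym_aux {t s : ℝ} (ht : t₀ ≤ t) (hs : t₀ ≤ s) :
    ∫ x in (0:ℝ)..π, (S.u x s * S.uxx x t - S.u x t * S.uxx x s) = 0 := by
  have h1 := ibp0 (S.hux s hs) (S.huxx t ht) (slice_cont S.cont_ux hs) (slice_cont S.cont_uxx ht)
    (S.bc0 s hs) (S.bcπ s hs)
  have h2 := ibp0 (S.hux t ht) (S.huxx s hs) (slice_cont S.cont_ux ht) (slice_cont S.cont_uxx hs)
    (S.bc0 t ht) (S.bcπ t ht)
  rw [intervalIntegral.integral_sub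
    (((slice_cont S.cont_u hs).fun_mul (slice_cont S.cont_uxx ht)).intervalIntegrable_of_Icc pi_pos.le)
    (((slice_cont S.cont_u ht).fun_mul (slice_cont S.cont_uxx hs)).intervalIntegrable_of_Icc pi_pos.le), h1, h2]
  simp only [mul_comm, sub_self]

lemma cont_fst {f : ℝ → ℝ → ℝ} {t₀ : ℝ}
    (hf : ContinuousOn (Function.uncurry f) (Icc 0 π ×ˢ Ici t₀)) {t : ℝ} (ht : t₀ ≤ t) :
    ContinuousOn (fun p : ℝ × ℝ => f p.1 t) (Icc 0 π ×ˢ Ici t₀) :=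
  (slice_cont hf ht).comp continuousOn_fst (fun _ hp => hp.1)

lemma sol_sym {t : ℝ} (ht : t₀ < t) :
    ∫ x in (0:ℝ)..π, (S.ut x t * S.uxx x t - S.u x t * S.uxxt x t) = 0 := by
  have h := param_deriv (f := fun x s => S.u x s * S.uxx x t - S.u x t * S.uxx x s)
    (f' := fun x s => S.ut x s * S.uxx x t - S.u x t * S.uxxt x s) ht
    ((S.cont_u.mul (cont_fst S.cont_uxx ht.le)).sub ((cont_fst S.cont_u ht.le).mul S.cont_uxx))
    ((S.cont_ut.mul (cont_fst S.cont_uxx ht.le)).sub ((cont_fst S.cont_u ht.le).mul S.cont_uxxt))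
    (fun x hx s hs => (((S.hut x hx s (mem_Ici.2 (le_of_lt hs))).hasDerivAt (Ici_mem_nhds hs)).mul_const _).sub
      (((S.huxxt x hx s (mem_Ici.2 (le_of_lt hs))).hasDerivAt (Ici_mem_nhds hs)).const_mul _))
  have h2 : HasDerivAt (fun s => ∫ x in (0:ℝ)..π, (S.u x s * S.uxx x t - S.u x t * S.uxx x s)) 0 t := by
    refine (hasDerivAt_const t (0:ℝ)).congr_of_eventuallyEq ?_
    filter_upwards [Ioi_mem_nhds ht] with s hs using sol_sym_aux S ht.le (le_of_lt hs)
  exact h.unique h2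

lemma slope_facts {f f' : ℝ → ℝ → ℝ} {t₀ t : ℝ} (ht : t₀ ≤ t)
    (hf' : ContinuousOn (Function.uncurry f') (Icc 0 π ×ˢ Ici t₀))
    (hd : ∀ x ∈ Icc (0:ℝ) π, ∀ t ∈ Ici t₀, HasDerivWithinAt (fun s => f x s) (f' x t) (Ici t₀) t) :
    (∃ M, ∀ x ∈ Icc (0:ℝ) π, ∀ s ∈ Ioo t (t+1), ‖slope (f x) t s‖ ≤ M) ∧
    ∀ x ∈ Icc (0:ℝ) π, Tendsto (fun s => slope (f x) t s) (nhdsWithin t (Ioi t)) (nhds (f' x t)) := by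
  constructor
  · obtain ⟨M, hM⟩ := param_bound hf' (t + 1)
    refine ⟨M, fun x hx s hs => ?_⟩
    have h1 := Convex.norm_image_sub_le_of_norm_hasDerivWithin_le (f := f x) (f' := f' x) (s := Icc t₀ (t+1)) (C := M)
      (fun y hy => (hd x hx y hy.1).mono Icc_subset_Ici_self) (fun y hy => hM x hx y hy) (convex_Icc _ _)
      (x := t) (y := s) ⟨ht, by linarith⟩ ⟨ht.trans hs.1.le, hs.2.le⟩
    rw [slope_def_field, norm_div, div_le_iff₀ (norm_pos_iff.2 (sub_ne_zero.2 hs.1.ne'))]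
    exact h1
  · intro x hx
    have := (hd x hx t ht).mono (Ioi_subset_Ici ht)
    exact (hasDerivWithinAt_iff_tendsto_slope' self_notMem_Ioi).1 this

lemma sol_wirt_t {t : ℝ} (ht : t₀ ≤ t) :
    ∫ x in (0:ℝ)..π, (S.ut x t * S.uxxt x t + S.ut x t ^ 2) ≤ 0 := by
  obtain ⟨⟨M1, hM1⟩, hT1⟩ := slope_facts ht S.cont_ut S.hut
  obtain ⟨⟨M2, hM2⟩, hT2⟩ := slope_facts ht S.cont_uxxt S.huxxt
  have hI : Ι (0:ℝ) π = Ioc 0 π := uIoc_of_le pi_pos.le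
  have hmem : Ioo t (t+1) ∈ nhdsWithin t (Ioi t) := Ioo_mem_nhdsGT (by linarith)
  have hcs : ∀ {g : ℝ → ℝ → ℝ}, ContinuousOn (Function.uncurry g) (Icc 0 π ×ˢ Ici t₀) →
      ∀ s, t₀ ≤ s → ContinuousOn (fun x => slope (g x) t s) (Icc 0 π) := by
    intro g hg s hs
    simp only [slope_def_field]
    exact ((slice_cont hg hs).sub (slice_cont hg ht)).div_const _
  have hlim := intervalIntegral.tendsto_integral_filter_of_dominated_convergence (a := 0) (b := π) (μ := volume)
    (l := nhdsWithin t (Ioi t)) (F := fun s x => slope (S.u x) t s * slope (S.uxx x) t s + slope (S.u x) t s ^ 2)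
    (f := fun x => S.ut x t * S.uxxt x t + S.ut x t ^ 2) (fun _ => M1 * M2 + M1 ^ 2) ?_ ?_ ?_ ?_
  · refine le_of_tendsto hlim ?_
    filter_upwards [hmem] with s hs
    have hs0 : t₀ ≤ s := ht.trans hs.1.le
    refine wirt (f := fun x => slope (S.u x) t s) (f' := fun x => slope (S.ux x) t s) (f'' := fun x => slope (S.uxx x) t s) ?_ ?_ (hcs S.cont_uxx s hs0) ?_ ?_
    · intro x hx
      simp only [slope_def_field]
      exact ((S.hux s hs0 x hx).sub (S.hux t ht x hx)).div_const _
    · intro x hx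
      simp only [slope_def_field]
      exact ((S.huxx s hs0 x hx).sub (S.huxx t ht x hx)).div_const _
    · simp [slope_def_field, S.bc0 s hs0, S.bc0 t ht]
    · simp [slope_def_field, S.bcπ s hs0, S.bcπ t ht]
  · filter_upwards [hmem] with s hs
    have hs0 : t₀ ≤ s := ht.trans hs.1.le
    rw [hI]
    exact ((((hcs S.cont_u s hs0).mul (hcs S.cont_uxx s hs0)).add ((hcs S.cont_u s hs0).pow 2)).mono
      Ioc_subset_Icc_self).aestronglyMeasurable measurableSet_Ioc
  · filter_upwards [hmem] with s hs
    refine Eventually.of_forall fun x hx => ?_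
    rw [hI] at hx
    have hx' := Ioc_subset_Icc_self hx
    have a1 := hM1 x hx' s hs
    have a2 := hM2 x hx' s hs
    refine (norm_add_le _ _).trans ?_
    rw [norm_mul, norm_pow]
    have : 0 ≤ M1 := (norm_nonneg _).trans a1
    gcongr
  · simp
  · refine Eventually.of_forall fun x hx => ?_
    rw [hI] at hx
    have hx' := Ioc_subset_Icc_self hx
    exact ((hT1 x hx').mul (hT2 x hx')).add ((hT1 x hx').pow 2)

/-- sup bound of `u` by the energy -/
lemma sol_sup {t : ℝ} (ht : t₀ ≤ t) {x : ℝ} (hx : x ∈ Icc (0:ℝ) π) :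
    |S.u x t| ≤ (π + ∫ y in (0:ℝ)..π, S.ux y t ^ 2) / 2 := by
  have cux := slice_cont S.cont_ux ht
  have cu := slice_cont S.cont_u ht
  have hsub : Icc 0 x ⊆ Icc 0 π := Icc_subset_Icc_right hx.2
  have h1 : ∫ y in (0:ℝ)..x, S.ux y t = S.u x t - S.u 0 t := by
    apply intervalIntegral.integral_eq_sub_of_hasDerivAt_of_le hx.1 (cu.mono hsub)
    · intro y hy
      exact (S.hux t ht y ⟨hy.1.le, hy.2.le.trans hx.2⟩).hasDerivAt (Icc_mem_nhds hy.1 (hy.2.trans_le hx.2))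
    · exact (cux.mono hsub).intervalIntegrable_of_Icc hx.1
  rw [S.bc0 t ht, sub_zero] at h1
  rw [← h1]
  have h2 := intervalIntegral.abs_integral_le_integral_abs (f := fun y => S.ux y t) (μ := volume) hx.1
  have h3 : ∫ y in (0:ℝ)..x, |S.ux y t| ≤ ∫ y in (0:ℝ)..π, |S.ux y t| := by
    apply intervalIntegral.integral_mono_interval le_rfl hx.1 hx.2
    · exact Eventually.of_forall fun y => abs_nonneg _
    · exact cux.abs.intervalIntegrable_of_Icc pi_pos.le
  have h4 : ∫ y in (0:ℝ)..π, |S.ux y t| ≤ ∫ y in (0:ℝ)..π, (1/2 + S.ux y t ^ 2 / 2) := by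
    apply intervalIntegral.integral_mono_on pi_pos.le
    · exact cux.abs.intervalIntegrable_of_Icc pi_pos.le
    · exact (continuousOn_const.add ((cux.pow 2).div_const 2)).intervalIntegrable_of_Icc pi_pos.le
    · intro y hy
      nlinarith [sq_nonneg (|S.ux y t| - 1), sq_abs (S.ux y t)]
  rw [intervalIntegral.integral_add (by simp) (((cux.fun_pow 2).div_const 2).intervalIntegrable_of_Icc pi_pos.le),
    intervalIntegral.integral_const, intervalIntegral.integral_div] at h4
  simp only [smul_eq_mul, sub_zero] at h4
  linarith

end sol


lemma int_comb {w q₁ q₂ q₃ q₄ : ℝ → ℝ} {α β m n : ℝ}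
    (hw : ContinuousOn w (Icc 0 π)) (h₁ : ContinuousOn q₁ (Icc 0 π)) (h₂ : ContinuousOn q₂ (Icc 0 π))
    (h₃ : ContinuousOn q₃ (Icc 0 π)) (h₄ : ContinuousOn q₄ (Icc 0 π))
    (hα : 0 ≤ α) (hβ : 0 ≤ β) (hm : 0 ≤ m)
    (i₁ : ∫ x in (0:ℝ)..π, q₁ x ≤ 0) (i₂ : ∫ x in (0:ℝ)..π, q₂ x ≤ 0)
    (i₃ : ∫ x in (0:ℝ)..π, q₃ x ≤ 0) (i₄ : ∫ x in (0:ℝ)..π, q₄ x = 0)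
    (h : ∀ x ∈ Ioo (0:ℝ) π, w x ≤ α * q₁ x + β * q₂ x + m * q₃ x + n * q₄ x) :
    ∫ x in (0:ℝ)..π, w x ≤ 0 := by
  have j₁ := (h₁.const_mul α).intervalIntegrable_of_Icc (μ := volume) pi_pos.le
  have j₂ := (h₂.const_mul β).intervalIntegrable_of_Icc (μ := volume) pi_pos.le
  have j₃ := (h₃.const_mul m).intervalIntegrable_of_Icc (μ := volume) pi_pos.le
  have j₄ := (h₄.const_mul n).intervalIntegrable_of_Icc (μ := volume) pi_pos.le
  have := intervalIntegral.integral_mono_on_of_le_Ioo pi_pos.le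
    (hw.intervalIntegrable_of_Icc (μ := volume) pi_pos.le) (((j₁.add j₂).add j₃).add j₄) h
  rw [intervalIntegral.integral_add ((j₁.add j₂).add j₃) j₄, intervalIntegral.integral_add (j₁.add j₂) j₃,
    intervalIntegral.integral_add j₁ j₂] at this
  simp only [intervalIntegral.integral_const_mul, i₄] at this
  have a1 := mul_nonpos_of_nonneg_of_nonpos hα i₁
  have a2 := mul_nonpos_of_nonneg_of_nonpos hβ i₂
  have a3 := mul_nonpos_of_nonneg_of_nonpos hm i₃
  linarith

section nonlin
variable {F F' : ℝ → ℝ} {k : ℝ}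

lemma F_mono (hFderiv : ∀ z, HasDerivAt F (F' z) z) (hFk : ∀ z, F' z ≤ k) :
    Monotone (fun z => k * z - F z) := by
  have hd : ∀ z, HasDerivAt (fun z => k * z - F z) (k - F' z) z := fun z =>
    (((hasDerivAt_id z).const_mul k).sub (hFderiv z)).congr_deriv (by ring)
  exact monotone_of_hasDerivAt_nonneg hd (fun z => sub_nonneg.2 (hFk z))

lemma F_mul (hFderiv : ∀ z, HasDerivAt F (F' z) z) (hFk : ∀ z, F' z ≤ k) (hF0 : F 0 = 0) (z : ℝ) :
    z * F z ≤ k * z ^ 2 := by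
  have hm := F_mono hFderiv hFk
  rcases le_total 0 z with h | h
  · have h1 := hm h
    simp only [hF0, mul_zero, sub_zero] at h1
    nlinarith [mul_nonneg h h1]
  · have h1 := hm h
    simp only [hF0, mul_zero, sub_zero] at h1
    nlinarith [mul_nonneg_of_nonpos_of_nonpos h h1]

lemma Phi_deriv (hFderiv : ∀ z, HasDerivAt F (F' z) z) (z : ℝ) :
    HasDerivAt (fun z => ∫ y in (0:ℝ)..z, F y) (F z) z := by
  have hc : Continuous F := continuous_iff_continuousAt.2 fun z => (hFderiv z).continuousAt
  exact intervalIntegral.integral_hasDerivAt_right (hc.intervalIntegrable _ _)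
    (hc.stronglyMeasurableAtFilter _ _) hc.continuousAt

lemma Phi_le (hFderiv : ∀ z, HasDerivAt F (F' z) z) (hFk : ∀ z, F' z ≤ k) (hF0 : F 0 = 0) (z : ℝ) :
    ∫ y in (0:ℝ)..z, F y ≤ k / 2 * z ^ 2 := by
  have hm := F_mono hFderiv hFk
  set h : ℝ → ℝ := fun z => k / 2 * z ^ 2 - ∫ y in (0:ℝ)..z, F y with hh
  have hd : ∀ z, HasDerivAt h (k * z - F z) z := fun z =>
    (((hasDerivAt_pow 2 z).const_mul (k/2)).sub (Phi_deriv hFderiv z)).congr_deriv (by push_cast; ring)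
  have hc : Continuous h := continuous_iff_continuousAt.2 fun z => (hd z).continuousAt
  have h0 : h 0 = 0 := by simp [hh]
  suffices 0 ≤ h z by simp only [hh] at this; linarith
  rw [← h0]
  rcases le_total 0 z with hz | hz
  · refine monotoneOn_of_deriv_nonneg (convex_Ici (0:ℝ)) hc.continuousOn
      (fun x _ => (hd x).differentiableAt.differentiableWithinAt) ?_ (self_mem_Ici) hz hz
    intro x hx
    rw [interior_Ici] at hx
    rw [(hd x).deriv]
    have := hm (le_of_lt hx)
    simpa [hF0] using this
  · refine antitoneOn_of_deriv_nonpos (convex_Iic (0:ℝ)) hc.continuousOn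
      (fun x _ => (hd x).differentiableAt.differentiableWithinAt) ?_ hz (self_mem_Iic) hz
    intro x hx
    rw [interior_Iic] at hx
    rw [(hd x).deriv]
    have := hm (le_of_lt hx)
    simpa [hF0] using this

end nonlin

/-- Energy density. -/
noncomputable def Vden {ε C F : ℝ → ℝ} {a' t₀ : ℝ} (ε' : ℝ → ℝ) (γ θ : ℝ)
    (S : ClassicalSolution ε C F a' t₀) (x t : ℝ) : ℝ :=
  γ / 2 * (S.ut x t ^ 2 - C t * (S.u x t * S.uxx x t)) - (γ + 1) * (∫ y in (0:ℝ)..(S.u x t), F y)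
  + 1 / 2 * ((ε t * S.uxx x t - S.ut x t) ^ 2 - (C t - ε' t + a' * ε t) * (S.u x t * S.uxx x t))
  + θ * (S.u x t * S.ut x t - 1 / 2 * (ε t * (S.u x t * S.uxx x t)))

/-- Its time derivative. -/
noncomputable def Vdot {ε C F : ℝ → ℝ} {a' t₀ : ℝ} (ε' ε'' C' : ℝ → ℝ) (γ θ : ℝ)
    (S : ClassicalSolution ε C F a' t₀) (x t : ℝ) : ℝ :=
  γ / 2 * (2 * S.ut x t * S.utt x t - (C' t * (S.u x t * S.uxx x t)
      + C t * (S.ut x t * S.uxx x t + S.u x t * S.uxxt x t))) - (γ + 1) * (F (S.u x t) * S.ut x t)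
  + 1 / 2 * (2 * (ε t * S.uxx x t - S.ut x t) * (ε' t * S.uxx x t + ε t * S.uxxt x t - S.utt x t)
    - ((C' t - ε'' t + a' * ε' t) * (S.u x t * S.uxx x t)
      + (C t - ε' t + a' * ε t) * (S.ut x t * S.uxx x t + S.u x t * S.uxxt x t)))
  + θ * (S.ut x t * S.ut x t + S.u x t * S.utt x t - 1 / 2 * (ε' t * (S.u x t * S.uxx x t)
      + ε t * (S.ut x t * S.uxx x t + S.u x t * S.uxxt x t)))

section energy
variable {ε ε' ε'' C C' F F' : ℝ → ℝ} {a' t₀ : ℝ} (S : ClassicalSolution ε C F a' t₀)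

lemma cont_snd {f : ℝ → ℝ} {t₀ : ℝ} (h0 : 0 ≤ t₀) (hf : ContinuousOn f (Ici 0)) :
    ContinuousOn (fun p : ℝ × ℝ => f p.2) (Icc (0:ℝ) π ×ˢ Ici t₀) :=
  hf.comp continuousOn_snd (fun _ hp => mem_Ici.2 (h0.trans hp.2))

lemma Vden_cont (γ θ : ℝ) (h0 : 0 ≤ t₀) (hε : ContinuousOn ε (Ici 0)) (hε' : ContinuousOn ε' (Ici 0))
    (hC : ContinuousOn C (Ici 0)) (hFderiv : ∀ z, HasDerivAt F (F' z) z) :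
    ContinuousOn (Function.uncurry (Vden ε' γ θ S)) (Icc 0 π ×ˢ Ici t₀) := by
  have ce := cont_snd h0 hε
  have ce' := cont_snd h0 hε'
  have cC := cont_snd h0 hC
  have hP : Continuous (fun z => ∫ y in (0:ℝ)..z, F y) :=
    continuous_iff_continuousAt.2 fun z => (Phi_deriv hFderiv z).continuousAt
  have cP := hP.comp_continuousOn S.cont_u
  have cuu := S.cont_u.mul S.cont_uxx
  exact (((((S.cont_ut.pow 2).sub (cC.mul cuu)).const_mul (γ/2)).sub (cP.const_mul (γ+1))).add
    (((((ce.mul S.cont_uxx).sub S.cont_ut).pow 2).sub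
      (((cC.sub ce').add (ce.const_mul a')).mul cuu)).const_mul (1/2))).add
    (((S.cont_u.mul S.cont_ut).sub ((ce.mul cuu).const_mul (1/2))).const_mul θ)

lemma Vdot_cont (γ θ : ℝ) (h0 : 0 ≤ t₀) (hε : ContinuousOn ε (Ici 0)) (hε' : ContinuousOn ε' (Ici 0))
    (hε'' : ContinuousOn ε'' (Ici 0)) (hC : ContinuousOn C (Ici 0)) (hC' : ContinuousOn C' (Ici 0))
    (hF : Continuous F) :
    ContinuousOn (Function.uncurry (Vdot ε' ε'' C' γ θ S)) (Icc 0 π ×ˢ Ici t₀) := by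
  have ce := cont_snd h0 hε
  have ce' := cont_snd h0 hε'
  have ce'' := cont_snd h0 hε''
  have cC := cont_snd h0 hC
  have cC' := cont_snd h0 hC'
  have cF := hF.comp_continuousOn S.cont_u
  have cuu := S.cont_u.mul S.cont_uxx
  have cd := (S.cont_ut.mul S.cont_uxx).add (S.cont_u.mul S.cont_uxxt)
  exact ((((((S.cont_ut.const_mul 2).mul S.cont_utt).sub ((cC'.mul cuu).add (cC.mul cd))).const_mul (γ/2)).sub
    ((cF.mul S.cont_ut).const_mul (γ+1))).add
    ((((((ce.mul S.cont_uxx).sub S.cont_ut).const_mul 2).mul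
      (((ce'.mul S.cont_uxx).add (ce.mul S.cont_uxxt)).sub S.cont_utt)).sub
      ((((cC'.sub ce'').add (ce'.const_mul a')).mul cuu).add
       (((cC.sub ce').add (ce.const_mul a')).mul cd))).const_mul (1/2))).add
    ((((S.cont_ut.mul S.cont_ut).add (S.cont_u.mul S.cont_utt)).sub
      (((ce'.mul cuu).add (ce.mul cd)).const_mul (1/2))).const_mul θ)

lemma Vden_deriv (γ θ : ℝ) {x t : ℝ} (hx : x ∈ Icc (0:ℝ) π) (ht : t₀ < t)
    (hε : HasDerivAt ε (ε' t) t) (hε' : HasDerivAt ε' (ε'' t) t) (hC : HasDerivAt C (C' t) t)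
    (hFderiv : ∀ z, HasDerivAt F (F' z) z) :
    HasDerivAt (fun s => Vden ε' γ θ S x s) (Vdot ε' ε'' C' γ θ S x t) t := by
  have du := (S.hut x hx t (mem_Ici.2 ht.le)).hasDerivAt (Ici_mem_nhds ht)
  have dut := (S.hutt x hx t (mem_Ici.2 ht.le)).hasDerivAt (Ici_mem_nhds ht)
  have duxx := (S.huxxt x hx t (mem_Ici.2 ht.le)).hasDerivAt (Ici_mem_nhds ht)
  have dP := (Phi_deriv hFderiv (S.u x t)).comp t du
  have duu := du.fun_mul duxx
  have d1 := ((((dut.fun_pow 2).fun_sub (hC.fun_mul duu)).const_mul (γ/2)).fun_sub (dP.const_mul (γ+1))).fun_add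
    (((((hε.fun_mul duxx).fun_sub dut).fun_pow 2).fun_sub
      (((hC.fun_sub hε').fun_add (hε.const_mul a')).fun_mul duu)).const_mul (1/2))
  have d2 := d1.fun_add (((du.fun_mul dut).fun_sub ((hε.fun_mul duu).const_mul (1/2))).const_mul θ)
  refine d2.congr_deriv ?_
  unfold Vdot
  push_cast
  ring

lemma pointwise_ineq {e e1 e2 c c1 u v w vt wt a a' f γ θ k μ p D m : ℝ}
    (pde : -e * wt + vt - c * w + a' * v = f - a * v)
    (he : 0 ≤ e) (hμ : 0 < μ) (hdiss : μ * (1 + e) ≤ c - e1) (ha : 0 ≤ a) (haD : a ≤ D)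
    (hf : u * f ≤ k * u ^ 2) (hγ : 0 ≤ γ) (hθ : 0 ≤ θ) (ha' : 0 ≤ a')
    (hm : m = θ * (c - e1 / 2) - (γ + 1) / 2 * c1 + e2 / 2 - a' * e1 / 2 - e * k)
    (hm1 : θ * k + 1 ≤ m) (hp : p ≤ e + a') (hγp : θ + θ ^ 2 * a' ^ 2 / 2 ≤ γ * p)
    (hγD : (θ ^ 2 / 2 + 1 / (4 * μ)) * D ≤ γ) :
    γ / 2 * (2 * v * vt - (c1 * (u * w) + c * (v * w + u * wt))) - (γ + 1) * (f * v)
    + 1 / 2 * (2 * (e * w - v) * (e1 * w + e * wt - vt)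
      - ((c1 - e2 + a' * e1) * (u * w) + (c - e1 + a' * e) * (v * w + u * wt)))
    + θ * (v * v + u * vt - 1 / 2 * (e1 * (u * w) + e * (v * w + u * wt)))
    ≤ (γ * e) * (v * wt + v ^ 2) + e * (-f * w + k * (u * w)) + m * (u * w + u ^ 2)
      + (1 / 2 * (γ * c + c - e1 + a' * e - θ * e)) * (v * w - u * wt) := by
  have hvt : vt = e * wt + c * w - a' * v + f - a * v := by linarith
  have key : γ / 2 * (2 * v * vt - (c1 * (u * w) + c * (v * w + u * wt))) - (γ + 1) * (f * v)
    + 1 / 2 * (2 * (e * w - v) * (e1 * w + e * wt - vt)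
      - ((c1 - e2 + a' * e1) * (u * w) + (c - e1 + a' * e) * (v * w + u * wt)))
    + θ * (v * v + u * vt - 1 / 2 * (e1 * (u * w) + e * (v * w + u * wt)))
    = (γ * e) * (v * wt + v ^ 2) + e * (-f * w + k * (u * w)) + m * (u * w + u ^ 2)
      + (1 / 2 * (γ * c + c - e1 + a' * e - θ * e)) * (v * w - u * wt)
      + (-γ * e * v ^ 2 - (γ + 1) * (a' + a) * v ^ 2 - e * (c - e1) * w ^ 2 + e * a * v * w - m * u ^ 2
        + θ * v ^ 2 + θ * (u * f) - θ * (a' + a) * u * v) := by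
    rw [hvt, hm]; ring
  rw [key]
  clear key hvt hm pde
  have r1 : e * (c - e1) * w ^ 2 ≥ μ * e ^ 2 * w ^ 2 := by
    have : e * (μ * (1 + e)) ≤ e * (c - e1) := mul_le_mul_of_nonneg_left hdiss he
    have h3 := mul_nonneg hμ.le he
    have h2 : μ * e ^ 2 ≤ e * (c - e1) := by linarith
    exact mul_le_mul_of_nonneg_right h2 (sq_nonneg w)
  have r2 : θ * (u * f) ≤ θ * (k * u ^ 2) := mul_le_mul_of_nonneg_left hf hθ
  have r3 : (θ * k + 1) * u ^ 2 ≤ m * u ^ 2 := mul_le_mul_of_nonneg_right hm1 (sq_nonneg u)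
  have r4 : -(θ * a' * u * v) ≤ u ^ 2 / 2 + θ ^ 2 * a' ^ 2 / 2 * v ^ 2 := by
    nlinarith [sq_nonneg (u + θ * a' * v)]
  have r5 : -(θ * a * u * v) ≤ u ^ 2 / 2 + θ ^ 2 * a ^ 2 / 2 * v ^ 2 := by
    nlinarith [sq_nonneg (u + θ * a * v)]
  have r6 : e * a * v * w ≤ μ * e ^ 2 * w ^ 2 + a ^ 2 * (1 / (4 * μ)) * v ^ 2 := by
    have h1 : μ * e ^ 2 * w ^ 2 + a ^ 2 * (1 / (4 * μ)) * v ^ 2 - e * a * v * w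
      = (2 * μ * e * w - a * v) ^ 2 * (1 / (4 * μ)) := by field_simp; ring
    have : 0 ≤ (2 * μ * e * w - a * v) ^ 2 * (1 / (4 * μ)) := by positivity
    linarith
  have r7 : (θ ^ 2 / 2 + 1 / (4 * μ)) * a ^ 2 * v ^ 2 ≤ γ * a * v ^ 2 := by
    have hq : 0 ≤ θ ^ 2 / 2 + 1 / (4 * μ) := by positivity
    have h1 : (θ ^ 2 / 2 + 1 / (4 * μ)) * a ≤ γ := (mul_le_mul_of_nonneg_left haD hq).trans hγD
    have h2 := mul_le_mul_of_nonneg_right h1 (mul_nonneg ha (sq_nonneg v))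
    calc (θ ^ 2 / 2 + 1 / (4 * μ)) * a ^ 2 * v ^ 2 = (θ ^ 2 / 2 + 1 / (4 * μ)) * a * (a * v ^ 2) := by ring
      _ ≤ γ * (a * v ^ 2) := h2
      _ = _ := by ring
  have r8 : (θ + θ ^ 2 * a' ^ 2 / 2) * v ^ 2 ≤ γ * (e + a') * v ^ 2 :=
    mul_le_mul_of_nonneg_right (hγp.trans (mul_le_mul_of_nonneg_left hp hγ)) (sq_nonneg v)
  have r9 : 0 ≤ (a' + a) * v ^ 2 := by positivity
  linarith

lemma V_deriv_nonpos {γ θ k μ p D t : ℝ} (h0 : 0 ≤ t₀) (ht : t₀ < t)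
    (hε : ContinuousOn ε (Ici 0)) (hε' : ContinuousOn ε' (Ici 0))
    (hε'' : ContinuousOn ε'' (Ici 0)) (hC : ContinuousOn C (Ici 0)) (hC' : ContinuousOn C' (Ici 0))
    (hFderiv : ∀ z, HasDerivAt F (F' z) z) (hF'cont : Continuous F') (hF0 : F 0 = 0) (hFk : ∀ z, F' z ≤ k)
    (hk : 0 ≤ k)
    (he : 0 ≤ ε t) (hμ : 0 < μ) (hdiss : μ * (1 + ε t) ≤ C t - ε' t)
    (haD : ∀ x ∈ Icc (0:ℝ) π, S.aa x t ≤ D) (hγ : 0 ≤ γ) (hθ : 0 ≤ θ) (ha' : 0 ≤ a')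
    (hm1 : θ * k + 1 ≤ θ * (C t - ε' t / 2) - (γ + 1) / 2 * C' t + ε'' t / 2 - a' * ε' t / 2 - ε t * k)
    (hp : p ≤ ε t + a') (hγp : θ + θ ^ 2 * a' ^ 2 / 2 ≤ γ * p)
    (hγD : (θ ^ 2 / 2 + 1 / (4 * μ)) * D ≤ γ) :
    ∫ x in (0:ℝ)..π, Vdot ε' ε'' C' γ θ S x t ≤ 0 := by
  have hF : Continuous F := continuous_iff_continuousAt.2 fun z => (hFderiv z).continuousAt
  have cu := slice_cont S.cont_u ht.le
  have cuxx := slice_cont S.cont_uxx ht.le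
  have cut := slice_cont S.cont_ut ht.le
  have cuxxt := slice_cont S.cont_uxxt ht.le
  have cF := hF.comp_continuousOn cu
  refine int_comb (slice_cont (Vdot_cont S γ θ h0 hε hε' hε'' hC hC' hF) ht.le)
    ((cut.mul cuxxt).add (cut.pow 2)) ((cF.neg.mul cuxx).add ((cu.mul cuxx).const_mul k))
    ((cu.mul cuxx).add (cu.pow 2)) ((cut.mul cuxx).sub (cu.mul cuxxt))
    (mul_nonneg hγ he) he ?_ (sol_wirt_t S ht.le) (sol_F S hFderiv hF'cont hF0 hFk ht.le) (sol_wirt S ht.le)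
    (sol_sym S ht) (fun x hx => pointwise_ineq (S.pde x hx t ht) he hμ hdiss
      (S.aa_nonneg x (mem_Icc_of_Ioo hx) t (mem_Ici.2 ht.le)) (haD x (mem_Icc_of_Ioo hx))
      (F_mul hFderiv hFk hF0 _) hγ hθ ha' rfl hm1 hp hγp hγD)
  have := mul_nonneg hθ hk
  linarith

lemma int_sub_le {f g : ℝ → ℝ} (hf : ContinuousOn f (Icc 0 π)) (hg : ContinuousOn g (Icc 0 π))
    (h : ∫ x in (0:ℝ)..π, (f x - g x) ≤ 0) : ∫ x in (0:ℝ)..π, f x ≤ ∫ x in (0:ℝ)..π, g x := by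
  rw [intervalIntegral.integral_sub (hf.intervalIntegrable_of_Icc pi_pos.le)
    (hg.intervalIntegrable_of_Icc pi_pos.le)] at h
  linarith

lemma d_sq (t : ℝ) : S.d t ^ 2 = ∫ x in (0:ℝ)..π,
    ((ε t)^2 * (S.uxx x t)^2 + (S.ux x t)^2 + (S.u x t)^2 + (S.ut x t)^2) := by
  unfold ClassicalSolution.d
  rw [Real.sq_sqrt]
  exact intervalIntegral.integral_nonneg pi_pos.le (fun x _ => by positivity)

lemma dens_cont (h0 : 0 ≤ t₀) (hε : ContinuousOn ε (Ici 0)) :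
    ContinuousOn (Function.uncurry fun x t =>
      (ε t)^2 * (S.uxx x t)^2 + (S.ux x t)^2 + (S.u x t)^2 + (S.ut x t)^2) (Icc 0 π ×ˢ Ici t₀) := by
  have ce := cont_snd h0 hε
  exact ((((ce.pow 2).mul (S.cont_uxx.pow 2)).add (S.cont_ux.pow 2)).add (S.cont_u.pow 2)).add (S.cont_ut.pow 2)

lemma d_cont (h0 : 0 ≤ t₀) (hε : ContinuousOn ε (Ici 0)) : ContinuousOn S.d (Ici t₀) :=
  (param_cont (dens_cont S h0 hε)).sqrt

lemma V_lower {γ θ k c₀ Cb t : ℝ} (h0 : 0 ≤ t₀) (ht : t₀ ≤ t)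
    (hε : ContinuousOn ε (Ici 0)) (hε' : ContinuousOn ε' (Ici 0)) (hC : ContinuousOn C (Ici 0))
    (hFderiv : ∀ z, HasDerivAt F (F' z) z) (hF0 : F 0 = 0) (hFk : ∀ z, F' z ≤ k)
    (hγ : 0 ≤ γ) (hk : 0 ≤ k) (hCb : 0 < Cb)
    (hN : (γ + 1) * k + Cb / 2 ≤ γ * C t + C t - ε' t + a' * ε t + θ * ε t)
    (hc1 : c₀ ≤ 1 / 4) (hc2 : c₀ ≤ Cb / 16) (hc0 : 0 ≤ c₀) (hγ2 : 3 * c₀ + 2 * θ ^ 2 / Cb ≤ γ / 2) :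
    c₀ * S.d t ^ 2 ≤ ∫ x in (0:ℝ)..π, Vden ε' γ θ S x t := by
  rw [d_sq, ← intervalIntegral.integral_const_mul]
  have cV := slice_cont (Vden_cont S γ θ h0 hε hε' hC hFderiv) ht
  have cD := (slice_cont (dens_cont S h0 hε) ht).const_mul c₀
  have cu := slice_cont S.cont_u ht
  have cux := slice_cont S.cont_ux ht
  have cuxx := slice_cont S.cont_uxx ht
  apply int_sub_le cD cV
  refine int_comb (α := (γ * C t + C t - ε' t + a' * ε t + θ * ε t) / 2 - c₀) (β := 0) (m := 0) (n := c₀)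
    (cD.sub cV) ((cu.mul cuxx).add (cu.pow 2)) (q₂ := fun _ => 0) (q₃ := fun _ => 0) continuousOn_const
    continuousOn_const ((cu.mul cuxx).add (cux.pow 2)) ?_ le_rfl le_rfl (sol_wirt S ht) (by simp) (by simp)
    (sol_ibp S ht) ?_
  · have : 0 ≤ (γ + 1) * k := by positivity
    linarith
  · intro x hx
    have hP := Phi_le hFderiv hFk hF0 (S.u x t)
    unfold Vden
    simp only [Pi.add_apply, Pi.mul_apply, Pi.pow_apply, mul_zero, add_zero]
    generalize (∫ y in (0:ℝ)..(S.u x t), F y) = P at *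
    generalize S.u x t = u at *
    generalize S.ut x t = v at *
    generalize S.uxx x t = w at *
    generalize S.ux x t = y at *
    generalize ε t = e at *
    set N := γ * C t + C t - ε' t + a' * e + θ * e with hNdef
    have r1 : (γ + 1) * P ≤ (γ + 1) * (k / 2 * u ^ 2) := mul_le_mul_of_nonneg_left hP (by linarith)
    have r2 : ((γ + 1) * k + Cb / 2) * u ^ 2 ≤ N * u ^ 2 := mul_le_mul_of_nonneg_right hN (sq_nonneg u)
    have r3 : -(θ * (u * v)) ≤ Cb / 8 * u ^ 2 + 2 * θ ^ 2 / Cb * v ^ 2 := by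
      have h1 : Cb / 8 * u ^ 2 + 2 * θ ^ 2 / Cb * v ^ 2 + θ * (u * v) = (Cb * u + 4 * θ * v) ^ 2 * (1 / (8 * Cb)) := by
        field_simp; ring
      have : 0 ≤ (Cb * u + 4 * θ * v) ^ 2 * (1 / (8 * Cb)) := by positivity
      linarith
    have r4 : c₀ * (e ^ 2 * w ^ 2) ≤ 2 * c₀ * (e * w - v) ^ 2 + 2 * c₀ * v ^ 2 := by
      nlinarith [mul_nonneg hc0 (sq_nonneg (e * w - 2 * v))]
    have r5 : 2 * c₀ * (e * w - v) ^ 2 ≤ 1 / 2 * (e * w - v) ^ 2 :=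
      mul_le_mul_of_nonneg_right (by linarith) (sq_nonneg _)
    have r6 : (3 * c₀ + 2 * θ ^ 2 / Cb) * v ^ 2 ≤ γ / 2 * v ^ 2 := mul_le_mul_of_nonneg_right hγ2 (sq_nonneg v)
    have r7 : 2 * c₀ * u ^ 2 ≤ Cb / 8 * u ^ 2 := mul_le_mul_of_nonneg_right (by linarith) (sq_nonneg u)
    have hNu : N * (u * w) = γ * (C t * (u * w)) + (C t - ε' t + a' * e) * (u * w) + θ * (e * (u * w)) := by
      rw [hNdef]; ring
    nlinarith

lemma V_upper {γ θ K B t : ℝ} (h0 : 0 ≤ t₀) (ht : t₀ ≤ t)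
    (hε : ContinuousOn ε (Ici 0)) (hε' : ContinuousOn ε' (Ici 0)) (hC : ContinuousOn C (Ici 0))
    (hFderiv : ∀ z, HasDerivAt F (F' z) z)
    (hγ : 0 ≤ γ) (hθ : 0 ≤ θ)
    (hN : γ * C t + C t - ε' t + a' * ε t + θ * ε t ≤ (γ + 1) * K) (hK : 2 + θ ≤ K)
    (hB : ∀ x ∈ Icc (0:ℝ) π, - B ≤ ∫ y in (0:ℝ)..(S.u x t), F y) :
    ∫ x in (0:ℝ)..π, Vden ε' γ θ S x t ≤ (γ + 1) * (K * S.d t ^ 2 + π * B) := by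
  have e1 : (γ + 1) * (K * S.d t ^ 2 + π * B) = ∫ x in (0:ℝ)..π, ((γ + 1) * K *
      ((ε t)^2 * (S.uxx x t)^2 + (S.ux x t)^2 + (S.u x t)^2 + (S.ut x t)^2) + (γ + 1) * B) := by
    rw [intervalIntegral.integral_add
      (((slice_cont (dens_cont S h0 hε) ht).const_mul _).intervalIntegrable_of_Icc pi_pos.le) (by simp),
      intervalIntegral.integral_const_mul, ← d_sq, intervalIntegral.integral_const]
    simp only [smul_eq_mul]; ring
  rw [e1]
  have cV := slice_cont (Vden_cont S γ θ h0 hε hε' hC hFderiv) ht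
  have cD := ((slice_cont (dens_cont S h0 hε) ht).const_mul ((γ + 1) * K)).add
    (continuousOn_const (c := (γ + 1) * B))
  have cu := slice_cont S.cont_u ht
  have cux := slice_cont S.cont_ux ht
  have cuxx := slice_cont S.cont_uxx ht
  apply int_sub_le cV cD
  refine int_comb (α := 0) (β := 0) (m := 0) (n := -(γ * C t + C t - ε' t + a' * ε t + θ * ε t) / 2)
    (cV.sub cD) (q₁ := fun _ => 0) (q₂ := fun _ => 0) (q₃ := fun _ => 0) continuousOn_const continuousOn_const
    continuousOn_const ((cu.mul cuxx).add (cux.pow 2)) le_rfl le_rfl le_rfl (by simp) (by simp) (by simp)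
    (sol_ibp S ht) ?_
  intro x hx
  have hP := hB x (mem_Icc_of_Ioo hx)
  unfold Vden
  simp only [Pi.add_apply, Pi.mul_apply, Pi.pow_apply, mul_zero, add_zero, zero_add]
  generalize (∫ y in (0:ℝ)..(S.u x t), F y) = P at *
  generalize S.u x t = u at *
  generalize S.ut x t = v at *
  generalize S.uxx x t = w at *
  generalize S.ux x t = y at *
  generalize ε t = e at *
  set N := γ * C t + C t - ε' t + a' * e + θ * e with hNdef
  have hNu : N * (u * w) = γ * (C t * (u * w)) + (C t - ε' t + a' * e) * (u * w) + θ * (e * (u * w)) := by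
    rw [hNdef]; ring
  have r1 : (γ + 1) * (-B) ≤ (γ + 1) * P := mul_le_mul_of_nonneg_left hP (by linarith)
  have r2 : N * y ^ 2 ≤ (γ + 1) * K * y ^ 2 := mul_le_mul_of_nonneg_right hN (sq_nonneg y)
  have hK2 : (γ + 1) * (2 + θ) ≤ (γ + 1) * K := mul_le_mul_of_nonneg_left hK (by linarith)
  have hγθ := mul_nonneg hγ hθ
  have r3 : (γ / 2 + 1 + θ / 2) * v ^ 2 ≤ (γ + 1) * K * v ^ 2 :=
    mul_le_mul_of_nonneg_right (by nlinarith) (sq_nonneg v)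
  have r4 : (θ / 2) * u ^ 2 ≤ (γ + 1) * K * u ^ 2 :=
    mul_le_mul_of_nonneg_right (by nlinarith) (sq_nonneg u)
  have r5 : 1 * (e ^ 2 * w ^ 2) ≤ (γ + 1) * K * (e ^ 2 * w ^ 2) :=
    mul_le_mul_of_nonneg_right (by nlinarith) (by positivity)
  have r6 : 1 / 2 * (e * w - v) ^ 2 ≤ e ^ 2 * w ^ 2 + v ^ 2 := by nlinarith [sq_nonneg (e * w + v)]
  have r7 : θ * (u * v) ≤ θ * (u ^ 2 / 2 + v ^ 2 / 2) :=
    mul_le_mul_of_nonneg_left (by nlinarith [sq_nonneg (u - v)]) hθ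
  have hKy : 0 ≤ (γ + 1) * K * y ^ 2 := mul_nonneg (by nlinarith) (sq_nonneg y)
  nlinarith

end energy

set_option maxHeartbeats 2000000 in
/-- Theorem 4.1, part 3 (eventual uniform boundedness): with `ρ = ∞`,
`0 ≤ τ < 1`, `sup_(t>0) g(t) < ∞` and `C'(t) → 0` as `t → ∞`, the solutions are
eventually uniformly bounded. -/
theorem solutions_eventually_uniformly_bounded
    (ε ε' ε'' C C' F F' : ℝ → ℝ) (a' A τ k μ Cbar εbar ebar : ℝ)
    (hεderiv : ∀ t ∈ Ici (0:ℝ), HasDerivWithinAt ε (ε' t) (Ici 0) t)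
    (hε'deriv : ∀ t ∈ Ici (0:ℝ), HasDerivWithinAt ε' (ε'' t) (Ici 0) t)
    (hε''cont : ContinuousOn ε'' (Ici 0))
    (hεnonneg : ∀ t ∈ Ici (0:ℝ), 0 ≤ ε t)
    (hCderiv : ∀ t ∈ Ici (0:ℝ), HasDerivWithinAt C (C' t) (Ici 0) t)
    (hC'cont : ContinuousOn C' (Ici 0))
    (hFderiv : ∀ z, HasDerivAt F (F' z) z)
    (hF'cont : Continuous F')
    (hF0 : F 0 = 0)
    (hCbar : IsGLB (C '' Ioi (0:ℝ)) Cbar) (hCbarpos : 0 < Cbar)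
    (hεbar : IsGLB (ε '' Ioi (0:ℝ)) εbar)
    (hebar : IsGLB (ε'' '' Ioi (0:ℝ)) ebar)
    (hA : 0 ≤ A) (hτ : 0 ≤ τ) (hk : 0 ≤ k) (hμ : 0 < μ)
    (hFk : ∀ z, F' z ≤ k)
    (hCk : k ≤ Cbar)
    (hdiss : ∀ t ∈ Ici (0:ℝ), μ * (1 + ε t) ≤ C t - ε' t)
    (hmuk : 0 < μ + Cbar / 2 - 2 * k)
    (ha' : 0 ≤ a')
    (ha'ε : 0 < a' + εbar / 2)
    (hτ1 : τ < 1)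
    (hg : ∃ gM, ∀ t ∈ Ioi (0:ℝ), C t - ε' t / 2 + 1 ≤ gM)
    (hC' : Tendsto C' atTop (nhds 0))
    :
    ∀ δ, 0 < δ →
      ∃ s, 0 ≤ s ∧ ∃ β, 0 < β ∧
        ∀ t₀, s ≤ t₀ →
          ∀ S : ClassicalSolution ε C F a' t₀,
            (∀ x ∈ Icc (0:ℝ) π, ∀ t ∈ Ici t₀, S.aa x t ≤ A * S.d t ^ τ) →
            S.d t₀ ≤ δ → ∀ t, t₀ ≤ t → S.d t < β := by
  intro δ hδ
  obtain ⟨gM, hgM⟩ := hg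
  have cε : ContinuousOn ε (Ici 0) := fun t ht => (hεderiv t ht).continuousWithinAt
  have cε' : ContinuousOn ε' (Ici 0) := fun t ht => (hε'deriv t ht).continuousWithinAt
  have cC : ContinuousOn C (Ici 0) := fun t ht => (hCderiv t ht).continuousWithinAt
  have bC : ∀ t, 1 ≤ t → Cbar ≤ C t := fun t ht => hCbar.1 ⟨t, mem_Ioi.2 (by linarith), rfl⟩
  have bε : ∀ t, 1 ≤ t → εbar ≤ ε t := fun t ht => hεbar.1 ⟨t, mem_Ioi.2 (by linarith), rfl⟩
  have bε'' : ∀ t, 1 ≤ t → ebar ≤ ε'' t := fun t ht => hebar.1 ⟨t, mem_Ioi.2 (by linarith), rfl⟩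
  have bg : ∀ t, 1 ≤ t → C t - ε' t / 2 + 1 ≤ gM := fun t ht => hgM t (mem_Ioi.2 (by linarith))
  have bd : ∀ t, 1 ≤ t → μ * (1 + ε t) ≤ C t - ε' t := fun t ht => hdiss t (mem_Ici.2 (by linarith))
  have bn : ∀ t, 1 ≤ t → 0 ≤ ε t := fun t ht => hεnonneg t (mem_Ici.2 (by linarith))
  have hεbar0 : 0 ≤ εbar := by
    refine hεbar.2 ?_
    rintro _ ⟨t, ht, rfl⟩
    exact hεnonneg t (mem_Ici.2 (le_of_lt ht))
  -- bounds
  set G := |gM| with hG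
  have hG0 : 0 ≤ G := abs_nonneg _
  have hGg : gM ≤ G := le_abs_self _
  have bε'u : ∀ t, 1 ≤ t → ε' t ≤ 2 * G := by
    intro t ht
    have := mul_nonneg hμ.le (bn t ht)
    linarith [bg t ht, bd t ht]
  have bε'l : ∀ t, 1 ≤ t → - (2 * G) ≤ ε' t := by
    intro t ht
    linarith [bg t ht, bC t ht]
  have bCu : ∀ t, 1 ≤ t → C t ≤ 2 * G := by
    intro t ht
    linarith [bg t ht, bε'u t ht]
  obtain ⟨E, hE0, bεu⟩ : ∃ E, 0 ≤ E ∧ ∀ t, 1 ≤ t → ε t ≤ E := by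
    refine ⟨max (ε 1) (G / μ), le_max_of_le_right (by positivity), fun t ht => ?_⟩
    refine image_le_of_deriv_right_lt_deriv_boundary' (f := ε) (f' := ε') (a := 1) (b := t)
      (B := fun _ => max (ε 1) (G / μ)) (B' := fun _ => 0)
      (cε.mono fun y hy => mem_Ici.2 (by linarith [hy.1])) ?_ (le_max_left _ _) continuousOn_const ?_ ?_
      (show t ∈ Icc 1 t from ⟨ht, le_rfl⟩)
    · intro y hy
      exact (hεderiv y (mem_Ici.2 (by linarith [hy.1]))).mono (Ici_subset_Ici.2 (by linarith [hy.1]))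
    · intro y hy
      exact hasDerivWithinAt_const _ _ _
    · intro y hy hyB
      have h1 : G / μ ≤ ε y := by rw [hyB]; exact le_max_right _ _
      rw [div_le_iff₀ hμ] at h1
      linarith [bg y hy.1, bd y hy.1]
  -- constants
  have hκ : 0 < Cbar / 2 + μ / 2 - k := by linarith
  obtain ⟨θ, hθ0, hθ⟩ : ∃ θ, 0 ≤ θ ∧
      2 + |ebar| / 2 + a' * G + E * k = θ * (Cbar / 2 + μ / 2 - k) := by
    refine ⟨(2 + |ebar| / 2 + a' * G + E * k) / (Cbar / 2 + μ / 2 - k), by positivity, ?_⟩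
    exact (div_mul_cancel₀ _ hκ.ne').symm
  obtain ⟨c₀, hc0, hc1, hc2⟩ : ∃ c₀ : ℝ, 0 < c₀ ∧ c₀ ≤ 1 / 4 ∧ c₀ ≤ Cbar / 16 :=
    ⟨min (1 / 4) (Cbar / 16), lt_min (by norm_num) (by positivity), min_le_left _ _, min_le_right _ _⟩
  set p := a' + εbar / 2 with hp
  obtain ⟨g0, hg01, hg0p, hg0c⟩ : ∃ g0 : ℝ, 1 ≤ g0 ∧ θ + θ ^ 2 * a' ^ 2 / 2 ≤ g0 * p ∧
      3 * c₀ + 2 * θ ^ 2 / Cbar ≤ g0 / 2 := by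
    have h1 : 0 ≤ (θ + θ ^ 2 * a' ^ 2 / 2) / p := by positivity
    have h2 : 0 ≤ 3 * c₀ + 2 * θ ^ 2 / Cbar := by positivity
    refine ⟨1 + (θ + θ ^ 2 * a' ^ 2 / 2) / p + 2 * (3 * c₀ + 2 * θ ^ 2 / Cbar), by linarith, ?_, by linarith⟩
    rw [← div_le_iff₀ ha'ε]
    linarith
  set g1 := (θ ^ 2 / 2 + 1 / (4 * μ)) * A with hg1
  have hg1n : 0 ≤ g1 := by positivity
  set K := 2 + θ + 2 * G + 2 * G + a' * E + θ * E with hK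
  have hFc : Continuous F := continuous_iff_continuousAt.2 fun z => (hFderiv z).continuousAt
  have hPc : Continuous (fun z => ∫ y in (0:ℝ)..z, F y) :=
    continuous_iff_continuousAt.2 fun z => (Phi_deriv hFderiv z).continuousAt
  obtain ⟨B, hB⟩ := (isCompact_Icc (a := -((π + δ ^ 2) / 2)) (b := (π + δ ^ 2) / 2)).exists_bound_of_continuousOn
    hPc.continuousOn
  have hB0 : 0 ≤ B := (norm_nonneg _).trans (hB 0 ⟨by have := pi_pos; nlinarith [sq_nonneg δ], by positivity⟩)
  set B2 := K * δ ^ 2 + π * B with hB2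
  have hB20 : 0 ≤ B2 := by positivity
  set R := max (δ + 1) ((g0 + 1 + g1) * B2 / c₀ + 1) with hR
  have hRδ : δ < R := by have := le_max_left (δ + 1) ((g0 + 1 + g1) * B2 / c₀ + 1); linarith
  have hR1 : 1 ≤ R := by have := le_max_left (δ + 1) ((g0 + 1 + g1) * B2 / c₀ + 1); linarith
  have hRB : (g0 + g1 * R + 1) * B2 < c₀ * R ^ 2 := by
    have h1 : (g0 + 1 + g1) * B2 / c₀ < R := by
      have := le_max_right (δ + 1) ((g0 + 1 + g1) * B2 / c₀ + 1); linarith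
    rw [div_lt_iff₀ hc0] at h1
    have h2 : g0 + g1 * R + 1 ≤ (g0 + 1 + g1) * R := by
      have := mul_nonneg (show 0 ≤ g0 + 1 by linarith) (show 0 ≤ R - 1 by linarith)
      linarith
    have h3 := mul_le_mul_of_nonneg_right h2 hB20
    have h4 := mul_lt_mul_of_pos_right h1 (show 0 < R by linarith)
    calc (g0 + g1 * R + 1) * B2 ≤ (g0 + 1 + g1) * R * B2 := h3
      _ = (g0 + 1 + g1) * B2 * R := by ring
      _ < R * c₀ * R := h4
      _ = c₀ * R ^ 2 := by ring
  set γ := g0 + g1 * R with hγ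
  have hγ1 : g0 ≤ γ := by have := mul_nonneg hg1n (show 0 ≤ R by linarith); linarith
  have hγ0 : 0 ≤ γ := by linarith
  have hev : ∀ᶠ t in atTop, C' t < 1 / (γ + 1) := hC'.eventually_lt_const (by positivity)
  obtain ⟨s0, hs0⟩ := eventually_atTop.1 hev
  refine ⟨max 1 s0, le_max_of_le_left zero_le_one, R, by linarith, ?_⟩
  intro t₀ ht₀ S haa hd0
  have ht1 : 1 ≤ t₀ := (le_max_left _ _).trans ht₀
  have hts : s0 ≤ t₀ := (le_max_right _ _).trans ht₀
  have ht0 : 0 ≤ t₀ := by linarith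
  by_contra hcon
  push Not at hcon
  obtain ⟨t1, ht1', hdt1⟩ := hcon
  have cd := d_cont S ht0 cε
  have hcomp : IsCompact (Icc t₀ t1 ∩ S.d ⁻¹' Ici R) := by
    refine isCompact_Icc.of_isClosed_subset ?_ inter_subset_left
    exact (cd.mono Icc_subset_Ici_self).preimage_isClosed_of_isClosed isClosed_Icc isClosed_Ici
  obtain ⟨T, ⟨hTm, hTR⟩, hTl⟩ := hcomp.exists_isLeast ⟨t1, ⟨ht1', le_rfl⟩, hdt1⟩
  have hTR' : R ≤ S.d T := hTR
  have hlt : ∀ t, t₀ ≤ t → t < T → S.d t < R := by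
    intro t h1 h2
    by_contra h3
    have := hTl ⟨⟨h1, h2.le.trans hTm.2⟩, not_lt.1 h3⟩
    linarith
  have hVd : ∀ t, t₀ < t → HasDerivAt (fun t => ∫ x in (0:ℝ)..π, Vden ε' γ θ S x t)
      (∫ x in (0:ℝ)..π, Vdot ε' ε'' C' γ θ S x t) t := by
    intro t ht
    refine param_deriv ht (Vden_cont S γ θ ht0 cε cε' cC hFderiv)
      (Vdot_cont S γ θ ht0 cε cε' hε''cont cC hC'cont hFc) ?_
    intro x hx s hs
    have hs' : t₀ < s := hs
    have hs2 : s ∈ Ici (0:ℝ) := mem_Ici.2 (by linarith)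
    have hn : Ici (0:ℝ) ∈ nhds s := Ici_mem_nhds (by linarith)
    exact Vden_deriv S γ θ hx hs ((hεderiv s hs2).hasDerivAt hn) ((hε'deriv s hs2).hasDerivAt hn)
      ((hCderiv s hs2).hasDerivAt hn) hFderiv
  have hanti : AntitoneOn (fun t => ∫ x in (0:ℝ)..π, Vden ε' γ θ S x t) (Icc t₀ T) := by
    refine antitoneOn_of_deriv_nonpos (convex_Icc _ _)
      ((param_cont (Vden_cont S γ θ ht0 cε cε' cC hFderiv)).mono Icc_subset_Ici_self) ?_ ?_
    · intro t ht
      rw [interior_Icc] at ht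
      exact (hVd t ht.1).differentiableAt.differentiableWithinAt
    · intro t ht
      rw [interior_Icc] at ht
      rw [(hVd t ht.1).deriv]
      have h1t : 1 ≤ t := by linarith [ht.1]
      refine V_deriv_nonpos S (k := k) (μ := μ) (p := p) (D := A * R) ht0 ht.1 cε cε' hε''cont cC hC'cont hFderiv hF'cont
        hF0 hFk hk (bn t h1t) hμ (bd t h1t) ?_ hγ0 hθ0 ha' ?_ ?_ ?_ ?_
      · intro x hx
        refine (haa x hx t (mem_Ici.2 ht.1.le)).trans (mul_le_mul_of_nonneg_left ?_ hA)
        have hdn : 0 ≤ S.d t := Real.sqrt_nonneg _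
        calc S.d t ^ τ ≤ R ^ τ := Real.rpow_le_rpow hdn (hlt t ht.1.le ht.2).le hτ
          _ ≤ R ^ (1:ℝ) := Real.rpow_le_rpow_of_exponent_le hR1 hτ1.le
          _ = R := Real.rpow_one R
      · have q1 := hs0 t (by linarith [ht.1])
        rw [lt_div_iff₀ (by linarith)] at q1
        have q2 : θ * (Cbar / 2 + μ / 2 - k) ≤ θ * (C t - ε' t / 2 - k) := by
          refine mul_le_mul_of_nonneg_left ?_ hθ0
          have := mul_nonneg hμ.le (bn t h1t)
          linarith [bd t h1t, bC t h1t]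
        have q3 := mul_le_mul_of_nonneg_left (bε'u t h1t) ha'
        have q4 := mul_le_mul_of_nonneg_right (bεu t h1t) hk
        have q5 := neg_abs_le ebar
        have q6 := bε'' t h1t
        rw [← hθ] at q2
        linarith
      · linarith [bε t h1t]
      · exact hg0p.trans (mul_le_mul_of_nonneg_right hγ1 ha'ε.le)
      · have : (θ ^ 2 / 2 + 1 / (4 * μ)) * (A * R) = g1 * R := by rw [hg1]; ring
        linarith
  have hT1 : 1 ≤ T := ht1.trans hTm.1
  have hlow := V_lower S (γ := γ) (θ := θ) (k := k) (c₀ := c₀) (Cb := Cbar) ht0 hTm.1 cε cε' cC hFderiv hF0 hFk hγ0 hk hCbarpos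
    (by
      have n1 := mul_nonneg ha' (bn T hT1)
      have n2 := mul_nonneg hθ0 (bn T hT1)
      have n3 := mul_nonneg hμ.le (bn T hT1)
      have n4 : γ * Cbar ≤ γ * C T := mul_le_mul_of_nonneg_left (bC T hT1) hγ0
      have n5 : 1 * (Cbar - k) ≤ γ * (Cbar - k) := mul_le_mul_of_nonneg_right (by linarith) (by linarith)
      linarith [bd T hT1]) hc1 hc2 hc0.le (by linarith)
  have hd0n : 0 ≤ S.d t₀ := Real.sqrt_nonneg _
  have hdsq : S.d t₀ ^ 2 ≤ δ ^ 2 := pow_le_pow_left₀ hd0n hd0 2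
  have hux2 : ∫ y in (0:ℝ)..π, S.ux y t₀ ^ 2 ≤ S.d t₀ ^ 2 := by
    rw [d_sq]
    refine intervalIntegral.integral_mono_on pi_pos.le
      (((slice_cont S.cont_ux le_rfl).pow 2).intervalIntegrable_of_Icc pi_pos.le)
      ((slice_cont (dens_cont S ht0 cε) le_rfl).intervalIntegrable_of_Icc pi_pos.le) ?_
    intro x hx
    have : 0 ≤ ε t₀ ^ 2 * S.uxx x t₀ ^ 2 := by positivity
    linarith [sq_nonneg (S.u x t₀), sq_nonneg (S.ut x t₀)]
  have hup := V_upper S (γ := γ) (θ := θ) (K := K) (B := B) ht0 le_rfl cε cε' cC hFderiv hγ0 hθ0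
    (by
      have n1 := mul_le_mul_of_nonneg_left (bεu t₀ ht1) ha'
      have n2 := mul_le_mul_of_nonneg_left (bεu t₀ ht1) hθ0
      have n4 : γ * C t₀ ≤ γ * (2 * G) := mul_le_mul_of_nonneg_left (bCu t₀ ht1) hγ0
      have n5 : 0 ≤ γ * (2 + θ + 2 * G + a' * E + θ * E) := by positivity
      have e : (γ + 1) * K = γ * (2 * G) + γ * (2 + θ + 2 * G + a' * E + θ * E) + K := by rw [hK]; ring
      rw [e]
      linarith [bε'l t₀ ht1, bCu t₀ ht1])
    (by
      have n1 := mul_nonneg ha' hE0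
      have n2 := mul_nonneg hθ0 hE0
      linarith)
    (by
      intro x hx
      have h1 := abs_le.1 ((sol_sup S le_rfl hx).trans (show _ ≤ (π + δ ^ 2) / 2 by linarith))
      exact (abs_le.1 (hB _ ⟨h1.1, h1.2⟩)).1)
  have hmono := hanti ⟨le_rfl, hTm.1⟩ ⟨hTm.1, le_rfl⟩ hTm.1
  simp only at hmono
  have hK0 : 0 ≤ K := by positivity
  have f1 : (γ + 1) * (K * S.d t₀ ^ 2 + π * B) ≤ (γ + 1) * B2 := by
    refine mul_le_mul_of_nonneg_left ?_ (by linarith)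
    have := mul_le_mul_of_nonneg_left hdsq hK0
    linarith
  have f2 : c₀ * R ^ 2 ≤ c₀ * S.d T ^ 2 :=
    mul_le_mul_of_nonneg_left (pow_le_pow_left₀ (by linarith) hTR' 2) hc0.le
  linarith
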